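/- Let A : V₁ → W₁ and B : V₂ → W₂ be linear maps between finite-dimensional real inner product spaces, with dim W₁ = n, and let k ≥ n be an integer. Suppose the operator norms satisfy ‖B‖ ≤ ‖A‖. Then the direct sum A ⊕ B : V₁ ⊕ V₂ → W₁ ⊕ W₂ (with the orthogonal direct sum inner products) satisfies ‖Λ^k (A ⊕ B)‖ ≤ ‖A‖^n · ‖B‖^{k−n}. -/

import Mathlib

/-!
Basic notions: the unit sphere `S^{d-1} ⊆ ℝ^d`, the norm `‖Λ^k A‖` of the induced map on
`k`-th exterior powers of a linear map between inner product spaces, and the `k`-dilation of a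
`C¹` map between unit spheres.  A (`C¹`) map from `S^{d₁-1}` to `S^{d₂-1}` is represented by a
(`C¹`) ambient map `F : ℝ^{d₁} → ℝ^{d₂}` mapping the unit sphere into the unit sphere; its
`k`-dilation only depends on the restriction of `F` to the sphere, since the derivative is
restricted to the tangent space of the sphere.
-/

open scoped RealInnerProductSpace
open Set

noncomputable section

abbrev EucA (d : ℕ) := EuclideanSpace ℝ (Fin d)

/-- The unit sphere `S^{d-1}` in `ℝ^d` (with the round metric induced from `ℝ^d`). -/
def usph (d : ℕ) : Set (EucA d) := Metric.sphere 0 1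

/-- The operator norm `‖Λ^k A‖` of the induced map on `k`-th exterior powers (with their induced
inner products): the supremum, over orthonormal `k`-frames `v` of the domain, of the `k`-volume
`√ det (⟪A vᵢ, A vⱼ⟫)` of the image frame `A v₁, …, A v_k`. -/
noncomputable def lamNorm {E F : Type*} [NormedAddCommGroup E] [InnerProductSpace ℝ E]
    [NormedAddCommGroup F] [InnerProductSpace ℝ F] (k : ℕ) (A : E →ₗ[ℝ] F) : ℝ :=
  ⨆ v : {v : Fin k → E // Orthonormal ℝ v},
    Real.sqrt (Matrix.of fun (i j : Fin k) => ⟪A (v.1 i), A (v.1 j)⟫).det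

/-- The `k`-dilation of a map of the unit sphere `S^{d-1}` into an inner product space (e.g. into
`ℝ^{d₂}`, for a map to the sphere `S^{d₂-1}`), the map being given by an ambient map `F`: the
supremum over points `x` of the sphere of `‖Λ^k df_x‖`, where `df_x` is the derivative of `F` at
`x` restricted to the tangent space `(ℝ∙x)ᗮ` of the sphere at `x`. -/
noncomputable def kDilation {d : ℕ} {F' : Type*} [NormedAddCommGroup F']
    [InnerProductSpace ℝ F'] (k : ℕ) (F : EucA d → F') : ℝ :=
  ⨆ x : usph d,
    lamNorm k ((fderiv ℝ F (x : EucA d)).toLinearMap ∘ₗ ((ℝ ∙ (x : EucA d))ᗮ).subtype)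

/-- The direct sum `A ⊕ B` of two linear maps, with the orthogonal (`ℓ²`) direct sum inner
product structures on domain and codomain. -/
noncomputable def orthDirectSum {V₁ W₁ V₂ W₂ : Type*}
    [NormedAddCommGroup V₁] [InnerProductSpace ℝ V₁]
    [NormedAddCommGroup W₁] [InnerProductSpace ℝ W₁]
    [NormedAddCommGroup V₂] [InnerProductSpace ℝ V₂]
    [NormedAddCommGroup W₂] [InnerProductSpace ℝ W₂]
    (A : V₁ →ₗ[ℝ] W₁) (B : V₂ →ₗ[ℝ] W₂) :
    WithLp 2 (V₁ × V₂) →ₗ[ℝ] WithLp 2 (W₁ × W₂) :=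
  (WithLp.linearEquiv 2 ℝ (W₁ × W₂)).symm.toLinearMap ∘ₗ (A.prodMap B) ∘ₗ
    (WithLp.linearEquiv 2 ℝ (V₁ × V₂)).toLinearMap

open Matrix in
/-- The eigenvalues of a symmetric matrix bounded above by `r • 1` are at most `r`. -/
lemma Matrix.IsHermitian.eigenvalues_le_of_posSemidef_sub {ι : Type*} [Fintype ι] [DecidableEq ι]
    {N : Matrix ι ι ℝ} (hN : N.IsHermitian) {r : ℝ} (h : (r • 1 - N).PosSemidef) (i : ι) :
    hN.eigenvalues i ≤ r := by
  have h1 := h.dotProduct_mulVec_nonneg (hN.eigenvectorBasis i)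
  have h2 : (hN.eigenvectorBasis i : ι → ℝ) ⬝ᵥ (hN.eigenvectorBasis i : ι → ℝ) = 1 := by
    have := hN.eigenvectorBasis.orthonormal.1 i
    rw [EuclideanSpace.norm_eq, Real.sqrt_eq_one] at this
    simpa [dotProduct, sq] using this
  simp only [sub_mulVec, smul_mulVec, one_mulVec, hN.mulVec_eigenvectorBasis, star_trivial,
    dotProduct_sub, dotProduct_smul, h2, smul_eq_mul, mul_one] at h1
  linarith

open Matrix in
/-- A positive semidefinite matrix dominated by a positive diagonal matrix has determinant at most
the product of the diagonal entries. -/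
lemma Matrix.PosSemidef.det_le_prod_of_diagonal_sub {ι : Type*} [Fintype ι] [DecidableEq ι]
    {G : Matrix ι ι ℝ} (hG : G.PosSemidef) {d : ι → ℝ} (hd : ∀ i, 0 < d i)
    (h : (diagonal d - G).PosSemidef) : G.det ≤ ∏ i, d i := by
  set S : Matrix ι ι ℝ := diagonal fun i => (√(d i))⁻¹ with hS
  have hSt : Sᴴ = S := by simp [hS]
  have hN : (S * G * S).PosSemidef := by
    simpa only [hSt] using hG.conjTranspose_mul_mul_same S
  have hSD : S * diagonal d * S = 1 := by
    rw [hS, diagonal_mul_diagonal, diagonal_mul_diagonal, ← diagonal_one]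
    congr 1
    funext i
    have h0 := Real.sqrt_pos.2 (hd i)
    have h1 := Real.mul_self_sqrt (hd i).le
    field_simp
    linarith
  have hle : ((1 : ℝ) • 1 - S * G * S).PosSemidef := by
    have := h.conjTranspose_mul_mul_same S
    rwa [hSt, mul_sub, sub_mul, hSD, ← one_smul ℝ (1 : Matrix ι ι ℝ)] at this
  have hdet : (S * G * S).det ≤ 1 := by
    rw [hN.1.det_eq_prod_eigenvalues]
    exact Finset.prod_le_one (fun i _ => hN.eigenvalues_nonneg i)
      fun i _ => hN.1.eigenvalues_le_of_posSemidef_sub hle i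
  have hprod : S.det * (∏ i, d i) * S.det = 1 := by
    rw [← det_diagonal, ← det_mul, ← det_mul, hSD, det_one]
  have hSpos : 0 < S.det := by
    rw [hS, det_diagonal]
    exact Finset.prod_pos fun i _ => inv_pos.2 (Real.sqrt_pos.2 (hd i))
  rw [det_mul, det_mul] at hdet
  have : S.det * G.det * S.det ≤ S.det * (∏ i, d i) * S.det := hdet.trans hprod.ge
  exact le_of_mul_le_mul_left (le_of_mul_le_mul_right this hSpos) hSpos

open Matrix in
/-- If `0 ≤ G ≤ β + c H` with `0 ≤ H` of rank at most `n` and `β + c H ≤ α` on the spectrum of `H`,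
then `det G ≤ α ^ n * β ^ (k - n)`. -/
lemma Matrix.PosSemidef.det_le_pow_mul_pow_of_rank_le {k n : ℕ} (hk : n ≤ k)
    {G H : Matrix (Fin k) (Fin k) ℝ} (hG : G.PosSemidef) (hH : H.PosSemidef) (hr : H.rank ≤ n)
    {α β c ρ : ℝ} (hβ : 0 < β) (hβα : β ≤ α) (hc : 0 ≤ c) (hρ : β + c * ρ ≤ α)
    (hHρ : (ρ • 1 - H).PosSemidef) (h : (β • 1 + c • H - G).PosSemidef) :
    G.det ≤ α ^ n * β ^ (k - n) := by
  set e := hH.1.eigenvalues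
  have he0 : ∀ i, 0 ≤ e i := hH.eigenvalues_nonneg
  have heρ : ∀ i, e i ≤ ρ := hH.1.eigenvalues_le_of_posSemidef_sub hHρ
  let U : Matrix (Fin k) (Fin k) ℝ := hH.1.eigenvectorUnitary.1
  have hUU : Uᴴ * U = 1 := Unitary.coe_star_mul_self hH.1.eigenvectorUnitary
  have hUH : Uᴴ * H * U = diagonal e := by
    have := hH.1.conjStarAlgAut_star_eigenvectorUnitary
    rwa [Unitary.conjStarAlgAut_star_apply] at this
  have hdet : (Uᴴ * G * U).det = G.det := by
    rw [det_mul_right_comm, hUU, one_mul]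
  have hdiag : Uᴴ * (β • 1 + c • H - G) * U = diagonal (fun i => β + c * e i) - Uᴴ * G * U := by
    rw [mul_sub, sub_mul, mul_add, add_mul, Matrix.mul_smul, Matrix.mul_smul, Matrix.smul_mul,
      Matrix.smul_mul, hUH, mul_one, hUU]
    congr 1
    ext i j
    by_cases hij : i = j <;> simp [hij, diagonal]
  have h1 := (hG.conjTranspose_mul_mul_same U).det_le_prod_of_diagonal_sub
    (d := fun i => β + c * e i) (fun i => by have := mul_nonneg hc (he0 i); linarith)
    (hdiag ▸ h.conjTranspose_mul_mul_same U)
  rw [hdet] at h1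
  refine h1.trans ?_
  have h2 : ∏ i, (β + c * e i) ≤ ∏ i, if e i ≠ 0 then α else β := by
    refine Finset.prod_le_prod (fun i _ => by have := mul_nonneg hc (he0 i); linarith) fun i _ => ?_
    split_ifs with h0
    · linarith [mul_le_mul_of_nonneg_left (heρ i) hc]
    · simp [not_not.1 h0]
  refine h2.trans ?_
  rw [hH.1.rank_eq_card_non_zero_eigs, Fintype.card_subtype] at hr
  rw [Finset.prod_ite, Finset.prod_const, Finset.prod_const]
  have hcard := Finset.card_filter_add_card_filter_not (s := (Finset.univ : Finset (Fin k)))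
    (fun i => e i ≠ 0)
  rw [Finset.card_univ, Fintype.card_fin] at hcard
  change (Finset.univ.filter fun i => e i ≠ 0).card ≤ n at hr
  set m := (Finset.univ.filter fun i => e i ≠ 0).card
  obtain ⟨p, rfl⟩ := Nat.exists_eq_add_of_le hr
  rw [show (Finset.univ.filter fun i => ¬ e i ≠ 0).card = p + (k - (m + p)) by omega, pow_add,
    pow_add, mul_assoc]
  have hα := hβ.le.trans hβα
  gcongr

/-- `lamNorm 1` is an upper bound for the dilation of a linear map. -/
lemma norm_apply_le_lamNorm_one {E F : Type*} [NormedAddCommGroup E] [InnerProductSpace ℝ E]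
    [FiniteDimensional ℝ E] [NormedAddCommGroup F] [InnerProductSpace ℝ F] (A : E →ₗ[ℝ] F)
    (x : E) : ‖A x‖ ≤ lamNorm 1 A * ‖x‖ := by
  have hval : ∀ v : Fin 1 → E,
      √(Matrix.of fun (i j : Fin 1) => ⟪A (v i), A (v j)⟫).det = ‖A (v 0)‖ := fun v => by
    rw [Matrix.det_fin_one, Matrix.of_apply, real_inner_self_eq_norm_sq,
      Real.sqrt_sq (norm_nonneg _)]
  rcases eq_or_ne x 0 with rfl | hx
  · simp
  have hx' := norm_pos_iff.2 hx
  have hu : Orthonormal ℝ (fun _ : Fin 1 => ‖x‖⁻¹ • x) := by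
    refine ⟨fun _ => ?_, fun i j hij => (hij (Subsingleton.elim i j)).elim⟩
    rw [norm_smul, norm_inv, norm_norm, inv_mul_cancel₀ hx'.ne']
  have hbdd : BddAbove (Set.range fun v : {v : Fin 1 → E // Orthonormal ℝ v} =>
      √(Matrix.of fun (i j : Fin 1) => ⟪A (v.1 i), A (v.1 j)⟫).det) := by
    refine ⟨‖A.toContinuousLinearMap‖, ?_⟩
    rintro _ ⟨v, rfl⟩
    simp only [hval]
    simpa [v.2.1 0] using A.toContinuousLinearMap.le_opNorm (v.1 0)
  have h : _ ≤ lamNorm 1 A := le_ciSup hbdd ⟨_, hu⟩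
  rw [hval, map_smul, norm_smul, norm_inv, norm_norm] at h
  rwa [inv_mul_le_iff₀ hx', mul_comm] at h

lemma lamNorm_nonneg {E F : Type*} [NormedAddCommGroup E] [InnerProductSpace ℝ E]
    [NormedAddCommGroup F] [InnerProductSpace ℝ F] (k : ℕ) (A : E →ₗ[ℝ] F) : 0 ≤ lamNorm k A :=
  Real.iSup_nonneg fun _ => Real.sqrt_nonneg _

open Matrix in
/-- A Gram matrix of vectors in an `n`-dimensional space has rank at most `n`. -/
lemma Matrix.rank_gram_le {ι E : Type*} [Fintype ι] [NormedAddCommGroup E]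
    [InnerProductSpace ℝ E] [FiniteDimensional ℝ E] (v : ι → E) :
    (gram ℝ v).rank ≤ Module.finrank ℝ E := by
  rw [gram_eq_conjTranspose_mul (stdOrthonormalBasis ℝ E)]
  exact (rank_mul_le_right _ _).trans ((rank_le_card_height _).trans_eq (Fintype.card_fin _))

lemma norm_sq_orthDirectSum {V₁ W₁ V₂ W₂ : Type*}
    [NormedAddCommGroup V₁] [InnerProductSpace ℝ V₁]
    [NormedAddCommGroup W₁] [InnerProductSpace ℝ W₁]
    [NormedAddCommGroup V₂] [InnerProductSpace ℝ V₂]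
    [NormedAddCommGroup W₂] [InnerProductSpace ℝ W₂]
    (A : V₁ →ₗ[ℝ] W₁) (B : V₂ →ₗ[ℝ] W₂) (x : WithLp 2 (V₁ × V₂)) :
    ‖orthDirectSum A B x‖ ^ 2 = ‖A x.fst‖ ^ 2 + ‖B x.snd‖ ^ 2 :=
  WithLp.prod_norm_sq_eq_of_L2 _

open Matrix in
lemma dotProduct_gram_comp_mulVec {ι E F : Type*} [Fintype ι]
    [NormedAddCommGroup E] [InnerProductSpace ℝ E] [NormedAddCommGroup F] [InnerProductSpace ℝ F]
    (T : E →ₗ[ℝ] F) (v : ι → E) (x : ι → ℝ) :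
    x ⬝ᵥ (gram ℝ (T ∘ v) *ᵥ x) = ‖T (∑ i, x i • v i)‖ ^ 2 := by
  have := star_dotProduct_gram_mulVec (𝕜 := ℝ) (T ∘ v) x x
  rw [star_trivial, real_inner_self_eq_norm_sq] at this
  simp [this]

open Matrix in
/-- The determinant bound for the image of an orthonormal frame under `A ⊕ B`, for positive
dilation bounds `b ≤ a`. -/
lemma det_gram_orthDirectSum_le {V₁ W₁ V₂ W₂ : Type*}
    [NormedAddCommGroup V₁] [InnerProductSpace ℝ V₁]
    [NormedAddCommGroup W₁] [InnerProductSpace ℝ W₁] [FiniteDimensional ℝ W₁]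
    [NormedAddCommGroup V₂] [InnerProductSpace ℝ V₂]
    [NormedAddCommGroup W₂] [InnerProductSpace ℝ W₂]
    (A : V₁ →ₗ[ℝ] W₁) (B : V₂ →ₗ[ℝ] W₂) {n k : ℕ}
    (hW₁ : Module.finrank ℝ W₁ = n) (hk : n ≤ k) {a b : ℝ} (hb : 0 < b) (hba : b ≤ a)
    (hA : ∀ x, ‖A x‖ ≤ a * ‖x‖) (hB : ∀ x, ‖B x‖ ≤ b * ‖x‖)
    {v : Fin k → WithLp 2 (V₁ × V₂)} (hv : Orthonormal ℝ v) :
    (gram ℝ (orthDirectSum A B ∘ v)).det ≤ (a ^ 2) ^ n * (b ^ 2) ^ (k - n) := by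
  have ha : 0 < a := hb.trans_le hba
  have hba2 : b ^ 2 ≤ a ^ 2 := by gcongr
  set A' : WithLp 2 (V₁ × V₂) →ₗ[ℝ] W₁ := A ∘ₗ WithLp.fstₗ 2 ℝ V₁ V₂
  have hA'x : ∀ x, A' x = A x.fst := fun _ => rfl
  have hnorm : ∀ x : Fin k → ℝ, ‖∑ i, x i • v i‖ ^ 2 = x ⬝ᵥ x := fun x => by
    have := star_dotProduct_gram_mulVec (𝕜 := ℝ) v x x
    rw [gram_eq_one_iff_orthonormal.2 hv, one_mulVec, star_trivial,
      real_inner_self_eq_norm_sq] at this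
    exact this.symm
  have hAsq : ∀ x, ‖A x‖ ^ 2 ≤ a ^ 2 * ‖x‖ ^ 2 := fun x => by
    rw [← mul_pow]; gcongr; exact hA x
  have hBsq : ∀ x, ‖B x‖ ^ 2 ≤ b ^ 2 * ‖x‖ ^ 2 := fun x => by
    rw [← mul_pow]; gcongr; exact hB x
  have hone : ∀ r : ℝ, (r • (1 : Matrix (Fin k) (Fin k) ℝ)).IsHermitian := fun r => by
    simp [IsHermitian]
  have hGH := isHermitian_gram ℝ (A' ∘ v)
  refine (posSemidef_gram ℝ _).det_le_pow_mul_pow_of_rank_le hk (posSemidef_gram ℝ (A' ∘ v))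
    (hW₁ ▸ rank_gram_le _) (c := 1 - b ^ 2 / a ^ 2) (ρ := a ^ 2) (by positivity) hba2 ?_ ?_ ?_ ?_
  · rw [sub_nonneg, div_le_one (by positivity)]
    exact hba2
  · field_simp
    linarith
  · refine .of_dotProduct_mulVec_nonneg ((hone _).sub hGH) fun x => ?_
    rw [star_trivial, sub_mulVec, dotProduct_sub, dotProduct_gram_comp_mulVec, smul_mulVec,
      one_mulVec, dotProduct_smul, ← hnorm, hA'x, smul_eq_mul, sub_nonneg]
    set y := ∑ i, x i • v i
    have h2 := WithLp.prod_norm_sq_eq_of_L2 y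
    refine (hAsq _).trans ?_
    refine mul_le_mul_of_nonneg_left ?_ (sq_nonneg a)
    linarith [sq_nonneg ‖y.snd‖]
  · refine .of_dotProduct_mulVec_nonneg
      (((hone _).add ?_).sub (isHermitian_gram ℝ _)) fun x => ?_
    · rw [IsHermitian, conjTranspose_smul, hGH.eq, star_trivial]
    rw [star_trivial, sub_mulVec, dotProduct_sub, add_mulVec, dotProduct_add, smul_mulVec,
      smul_mulVec, dotProduct_smul, dotProduct_smul, dotProduct_gram_comp_mulVec,
      dotProduct_gram_comp_mulVec, one_mulVec, ← hnorm, hA'x, norm_sq_orthDirectSum, smul_eq_mul,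
      smul_eq_mul]
    set y := ∑ i, x i • v i
    have h2 := WithLp.prod_norm_sq_eq_of_L2 y
    have h3 : b ^ 2 / a ^ 2 * ‖A y.fst‖ ^ 2 ≤ b ^ 2 * ‖y.fst‖ ^ 2 := by
      rw [div_mul_eq_mul_div, div_le_iff₀ (by positivity)]
      linarith [mul_le_mul_of_nonneg_left (hAsq y.fst) (sq_nonneg b)]
    have h4 := hBsq y.snd
    rw [h2]
    linarith

/-- Let `A : V₁ → W₁` and `B : V₂ → W₂` be linear maps between finite-dimensional real inner
product spaces with `dim W₁ = n`, let `k ≥ n`, and suppose the operator norms satisfy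
`‖B‖ ≤ ‖A‖` (the operator norm being `lamNorm 1`).  Then the direct sum `A ⊕ B` (with the
orthogonal direct sum inner products) satisfies `‖Λ^k (A ⊕ B)‖ ≤ ‖A‖^n · ‖B‖^{k-n}`. -/
theorem lamNorm_orthDirectSum_le {V₁ W₁ V₂ W₂ : Type*}
    [NormedAddCommGroup V₁] [InnerProductSpace ℝ V₁] [FiniteDimensional ℝ V₁]
    [NormedAddCommGroup W₁] [InnerProductSpace ℝ W₁] [FiniteDimensional ℝ W₁]
    [NormedAddCommGroup V₂] [InnerProductSpace ℝ V₂] [FiniteDimensional ℝ V₂]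
    [NormedAddCommGroup W₂] [InnerProductSpace ℝ W₂] [FiniteDimensional ℝ W₂]
    (A : V₁ →ₗ[ℝ] W₁) (B : V₂ →ₗ[ℝ] W₂) (n k : ℕ)
    (hW₁ : Module.finrank ℝ W₁ = n) (hk : n ≤ k)
    (hBA : lamNorm 1 B ≤ lamNorm 1 A) :
    lamNorm k (orthDirectSum A B) ≤ lamNorm 1 A ^ n * lamNorm 1 B ^ (k - n) := by
  have ha := lamNorm_nonneg 1 A
  have hb := lamNorm_nonneg 1 B
  set a := lamNorm 1 A
  set b := lamNorm 1 B
  refine Real.iSup_le (fun v => ?_) (by positivity)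
  have key : ∀ ε : ℝ, 0 < ε →
      √(Matrix.of fun (i j : Fin k) =>
        ⟪orthDirectSum A B (v.1 i), orthDirectSum A B (v.1 j)⟫).det
        ≤ (a + ε) ^ n * (b + ε) ^ (k - n) := fun ε hε => by
    refine Real.sqrt_le_iff.2 ⟨by positivity, ?_⟩
    have h := det_gram_orthDirectSum_le A B hW₁ hk (a := a + ε) (b := b + ε) (by positivity)
      (by linarith)
      (fun x => (norm_apply_le_lamNorm_one A x).trans
        (mul_le_mul_of_nonneg_right (by linarith) (norm_nonneg x)))
      (fun x => (norm_apply_le_lamNorm_one B x).trans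
        (mul_le_mul_of_nonneg_right (by linarith) (norm_nonneg x))) v.2
    rw [mul_pow, pow_right_comm (a + ε), pow_right_comm (b + ε)]
    exact h
  have hcont : Filter.Tendsto (fun ε : ℝ => (a + ε) ^ n * (b + ε) ^ (k - n))
      (nhdsWithin 0 (Ioi 0)) (nhds (a ^ n * b ^ (k - n))) := by
    have : Continuous fun ε : ℝ => (a + ε) ^ n * (b + ε) ^ (k - n) := by fun_prop
    simpa using (this.tendsto 0).mono_left nhdsWithin_le_nhds
  exact ge_of_tendsto hcont (Filter.eventually_of_mem self_mem_nhdsWithin key)
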